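/- For density operators ρ, σ_A ⊗ σ_B on a finite-dimensional bipartite Hilbert space, the quantum relative entropy satisfies S(ρ ‖ σ_A ⊗ σ_B) = S(ρ ‖ ρ_A ⊗ ρ_B) + S(ρ_A ‖ σ_A) + S(ρ_B ‖ σ_B), where ρ_A, ρ_B are the marginals of ρ; consequently the mutual information I(ρ) = S(ρ_A)+S(ρ_B)−S(ρ) equals min over uncorrelated states σ_A ⊗ σ_B of S(ρ ‖ σ_A ⊗ σ_B). -/

import Mathlib

open Matrix
open scoped ComplexOrder Kronecker

/-- Matrix logarithm of a Hermitian matrix via its spectral decomposition, with the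
convention `ln 0 = 0` on the kernel (`Real.log 0 = 0`). -/
noncomputable def matLog {n : Type*} [Fintype n] [DecidableEq n]
    (A : Matrix n n ℂ) (hA : A.IsHermitian) : Matrix n n ℂ :=
  (hA.eigenvectorUnitary : Matrix n n ℂ)
    * Matrix.diagonal (fun i => (Real.log (hA.eigenvalues i) : ℂ))
    * star (hA.eigenvectorUnitary : Matrix n n ℂ)

/-- Quantum relative entropy `S(ρ‖σ) = tr(ρ ln ρ − ρ ln σ)` (real part of the trace),
meaningful when `supp ρ ⊆ supp σ`. -/
noncomputable def relEntropy {n : Type*} [Fintype n] [DecidableEq n]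
    (ρ σ : Matrix n n ℂ) (hρ : ρ.IsHermitian) (hσ : σ.IsHermitian) : ℝ :=
  (Matrix.trace (ρ * (matLog ρ hρ - matLog σ hσ))).re

/-- Von Neumann entropy `S(ρ) = −tr(ρ ln ρ) = −Σᵢ λᵢ ln λᵢ`. -/
noncomputable def vonNeumannEntropy {n : Type*} [Fintype n] [DecidableEq n]
    {A : Matrix n n ℂ} (hA : A.IsHermitian) : ℝ :=
  ∑ i, Real.negMulLog (hA.eigenvalues i)

/-- Functional calculus via the chosen spectral decomposition. -/
noncomputable def fcalc {n : Type*} [Fintype n] [DecidableEq n]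
    {A : Matrix n n ℂ} (hA : A.IsHermitian) (f : ℝ → ℝ) : Matrix n n ℂ :=
  (hA.eigenvectorUnitary : Matrix n n ℂ)
    * Matrix.diagonal (fun i => (f (hA.eigenvalues i) : ℂ))
    * star (hA.eigenvectorUnitary : Matrix n n ℂ)

section
variable {n : Type*} [Fintype n] [DecidableEq n]

theorem fcalc_log {A : Matrix n n ℂ} (hA : A.IsHermitian) : matLog A hA = fcalc hA Real.log := rfl

theorem U_star_U {A : Matrix n n ℂ} (hA : A.IsHermitian) :
    star (hA.eigenvectorUnitary : Matrix n n ℂ) * (hA.eigenvectorUnitary : Matrix n n ℂ) = 1 :=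
  Unitary.coe_star_mul_self _

theorem U_U_star {A : Matrix n n ℂ} (hA : A.IsHermitian) :
    (hA.eigenvectorUnitary : Matrix n n ℂ) * star (hA.eigenvectorUnitary : Matrix n n ℂ) = 1 :=
  Unitary.coe_mul_star_self _

theorem fcalc_id {A : Matrix n n ℂ} (hA : A.IsHermitian) : fcalc hA (fun x => x) = A := by
  conv_rhs => rw [hA.spectral_theorem]
  rfl

theorem fcalc_one {A : Matrix n n ℂ} (hA : A.IsHermitian) : fcalc hA (fun _ => 1) = 1 := by
  simp [fcalc]

theorem fcalc_mul {A : Matrix n n ℂ} (hA : A.IsHermitian) (f g : ℝ → ℝ) :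
    fcalc hA f * fcalc hA g = fcalc hA (fun x => f x * g x) := by
  have h := U_star_U hA
  unfold fcalc
  set U := (hA.eigenvectorUnitary : Matrix n n ℂ)
  calc _ = U * diagonal (fun i => (f (hA.eigenvalues i) : ℂ)) * (star U * U)
        * diagonal (fun i => (g (hA.eigenvalues i) : ℂ)) * star U := by
          simp only [Matrix.mul_assoc]
    _ = _ := by
      rw [h, Matrix.mul_one, Matrix.mul_assoc U, diagonal_mul_diagonal]
      simp

theorem fcalc_sub {A : Matrix n n ℂ} (hA : A.IsHermitian) (f g : ℝ → ℝ) :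
    fcalc hA f - fcalc hA g = fcalc hA (fun x => f x - g x) := by
  unfold fcalc
  rw [← Matrix.sub_mul, ← Matrix.mul_sub, diagonal_sub]
  simp

theorem fcalc_herm {A : Matrix n n ℂ} (hA : A.IsHermitian) (f : ℝ → ℝ) :
    (fcalc hA f)ᴴ = fcalc hA f := by
  unfold fcalc
  simp only [star_eq_conjTranspose, conjTranspose_mul, conjTranspose_conjTranspose,
    diagonal_conjTranspose, Matrix.mul_assoc]
  congr 3
  ext i
  simp

theorem fcalc_trace {A : Matrix n n ℂ} (hA : A.IsHermitian) (f : ℝ → ℝ) :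
    (fcalc hA f).trace = ((∑ i, f (hA.eigenvalues i) : ℝ) : ℂ) := by
  unfold fcalc
  rw [trace_mul_comm, ← Matrix.mul_assoc, U_star_U, Matrix.one_mul, trace_diagonal]
  simp

theorem spec_unique (U V : Matrix n n ℂ) (hU : star U * U = 1) (hU' : U * star U = 1)
    (hV : star V * V = 1) (hV' : V * star V = 1) (d e : n → ℝ) (f : ℝ → ℝ)
    (h : U * diagonal (fun i => (d i : ℂ)) * star U = V * diagonal (fun i => (e i : ℂ)) * star V) :
    U * diagonal (fun i => (f (d i) : ℂ)) * star U
      = V * diagonal (fun i => (f (e i) : ℂ)) * star V := by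
  have key : diagonal (fun i => (d i : ℂ)) * (star U * V)
      = (star U * V) * diagonal (fun i => (e i : ℂ)) := by
    calc _ = (star U * U) * diagonal (fun i => (d i : ℂ)) * (star U * V) := by rw [hU, Matrix.one_mul]
      _ = star U * (U * diagonal (fun i => (d i : ℂ)) * star U) * V := by simp only [Matrix.mul_assoc]
      _ = (star U * V) * diagonal (fun i => (e i : ℂ)) * (star V * V) := by
        rw [h]; simp only [Matrix.mul_assoc]
      _ = _ := by rw [hV, Matrix.mul_one]
  have key2 : diagonal (fun i => (f (d i) : ℂ)) * (star U * V)
      = (star U * V) * diagonal (fun i => (f (e i) : ℂ)) := by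
    ext i j
    have := congrFun (congrFun key i) j
    rw [diagonal_mul, mul_diagonal] at this ⊢
    by_cases hw : (star U * V) i j = 0
    · simp [hw]
    · rw [mul_comm] at this
      have h3 : d i = e j := by exact_mod_cast mul_left_cancel₀ hw this
      rw [h3, mul_comm]
  calc _ = U * diagonal (fun i => (f (d i) : ℂ)) * star U * (V * star V) := by
        rw [hV', Matrix.mul_one]
    _ = U * (diagonal (fun i => (f (d i) : ℂ)) * (star U * V)) * star V := by
      simp only [Matrix.mul_assoc]
    _ = (U * star U) * V * diagonal (fun i => (f (e i) : ℂ)) * star V := by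
      rw [key2]; simp only [Matrix.mul_assoc]
    _ = _ := by rw [hU', Matrix.one_mul]

/-- overlap trace formula -/
theorem trace_fcalc_mul {A B : Matrix n n ℂ} (hA : A.IsHermitian) (hB : B.IsHermitian)
    (f g : ℝ → ℝ) :
    (fcalc hA f * fcalc hB g).trace.re = ∑ i, ∑ j, f (hA.eigenvalues i) * g (hB.eigenvalues j) *
      Complex.normSq ((star (hA.eigenvectorUnitary : Matrix n n ℂ)
        * (hB.eigenvectorUnitary : Matrix n n ℂ)) i j) := by
  unfold fcalc
  set U := (hA.eigenvectorUnitary : Matrix n n ℂ)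
  set V := (hB.eigenvectorUnitary : Matrix n n ℂ)
  have : (U * diagonal (fun i => (f (hA.eigenvalues i) : ℂ)) * star U *
      (V * diagonal (fun i => (g (hB.eigenvalues i) : ℂ)) * star V)).trace
      = (diagonal (fun i => (f (hA.eigenvalues i) : ℂ)) * (star U * V) *
        (diagonal (fun i => (g (hB.eigenvalues i) : ℂ)) * star (star U * V))).trace := by
    rw [Matrix.mul_assoc, Matrix.mul_assoc, trace_mul_comm]
    simp only [star_mul, star_star, Matrix.mul_assoc]
  rw [this, trace]
  simp only [diag_apply, mul_apply (M := _ * (star U * V)), diagonal_mul, Complex.re_sum]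
  refine Finset.sum_congr rfl fun i _ => Finset.sum_congr rfl fun j _ => ?_
  rw [star_apply]
  generalize (star U * V) i j = w
  have : (f (hA.eigenvalues i) : ℂ) * w * ((g (hB.eigenvalues j) : ℂ) * star w)
     = ((f (hA.eigenvalues i) * g (hB.eigenvalues j) * Complex.normSq w : ℝ) : ℂ) := by
    push_cast
    rw [← Complex.mul_conj]
    simp only [RCLike.star_def]
    ring
  rw [this, Complex.ofReal_re]

noncomputable def sind (x : ℝ) : ℝ := if x = 0 then 0 else 1

theorem klein {A B : Matrix n n ℂ} (hA : A.PosSemidef) (hB : B.PosSemidef)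
    (htr : A.trace = B.trace) (hs : A * fcalc hB.1 sind = A) :
    0 ≤ relEntropy A B hA.1 hB.1 := by
  have e1 := trace_fcalc_mul hA.1 hB.1 (fun x => x * Real.log x) (fun _ => 1)
  have e2 := trace_fcalc_mul hA.1 hB.1 (fun x => x) Real.log
  have e3 := trace_fcalc_mul hA.1 hB.1 (fun x => x) (fun _ => 1)
  have e4 := trace_fcalc_mul hA.1 hB.1 (fun _ => 1) (fun x => x)
  have e5 := trace_fcalc_mul hA.1 hB.1 (fun x => x) (fun x => 1 - sind x)
  rw [← fcalc_sub, fcalc_one, fcalc_id, Matrix.mul_sub, hs, Matrix.mul_one, sub_self] at e5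
  rw [fcalc_one, Matrix.mul_one, ← fcalc_mul, fcalc_id] at e1
  rw [fcalc_id] at e2
  rw [fcalc_one, Matrix.mul_one, fcalc_id] at e3
  rw [fcalc_one, Matrix.one_mul, fcalc_id, ← htr] at e4
  rw [e3] at e4
  have hp := hA.eigenvalues_nonneg
  have hq := hB.eigenvalues_nonneg
  have hs0 : ∀ x, 0 ≤ 1 - sind x := by intro x; unfold sind; split_ifs <;> simp
  rw [relEntropy, Matrix.mul_sub, trace_sub, Complex.sub_re, fcalc_log, fcalc_log, e1, e2]
  generalize star (hA.1.eigenvectorUnitary : Matrix n n ℂ)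
        * (hB.1.eigenvectorUnitary : Matrix n n ℂ) = W at *
  simp only [trace_zero, Complex.zero_re] at e5
  have hz : ∀ i j, hA.1.eigenvalues i * (1 - sind (hB.1.eigenvalues j)) *
      Complex.normSq (W i j) = 0 := by
    have h0 : ∀ i j, 0 ≤ hA.1.eigenvalues i * (1 - sind (hB.1.eigenvalues j)) *
      Complex.normSq (W i j) := fun i j =>
        mul_nonneg (mul_nonneg (hp i) (hs0 _)) (Complex.normSq_nonneg _)
    intro i j
    have h1 := (Finset.sum_eq_zero_iff_of_nonneg
      (fun i _ => Finset.sum_nonneg fun j _ => h0 i j)).1 e5.symm i (Finset.mem_univ i)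
    exact (Finset.sum_eq_zero_iff_of_nonneg (fun j _ => h0 i j)).1 h1 j (Finset.mem_univ j)
  have hle : ∑ i, ∑ j, (hA.1.eigenvalues i * 1 * Complex.normSq (W i j)
      - 1 * hB.1.eigenvalues j * Complex.normSq (W i j)) ≤
      ∑ i, ∑ j, (hA.1.eigenvalues i * Real.log (hA.1.eigenvalues i) * 1 * Complex.normSq (W i j)
       - hA.1.eigenvalues i * Real.log (hB.1.eigenvalues j) * Complex.normSq (W i j)) := by
    refine Finset.sum_le_sum fun i _ => Finset.sum_le_sum fun j _ => ?_
    have hz := hz i j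
    have hp := hp i
    have hq := hq j
    have hw := Complex.normSq_nonneg (W i j)
    generalize hA.1.eigenvalues i = p at *
    generalize hB.1.eigenvalues j = q at *
    generalize Complex.normSq (W i j) = w at *
    rcases hq.eq_or_lt with rfl | hq
    · simp only [sind, if_true, sub_zero, mul_one] at hz
      have : p * Real.log p * w = (p * w) * Real.log p := by ring
      simp [hz, this]
    · rcases hp.eq_or_lt with rfl | hp
      · simp; positivity
      · have h1 := Real.log_le_sub_one_of_pos (div_pos hq hp)
        rw [Real.log_div hq.ne' hp.ne'] at h1
        have h2 : p * (Real.log q - Real.log p) ≤ p * (q / p - 1) :=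
          mul_le_mul_of_nonneg_left h1 hp.le
        have h3 : p * (q / p - 1) = q - p := by field_simp
        rw [h3] at h2
        nlinarith [mul_le_mul_of_nonneg_right h2 hw]
  simp only [Finset.sum_sub_distrib] at hle
  linarith

theorem trace_self_log {A : Matrix n n ℂ} (hA : A.IsHermitian) :
    (A * matLog A hA).trace.re = - vonNeumannEntropy hA := by
  have : A * matLog A hA = fcalc hA (fun x => x * Real.log x) := by
    rw [fcalc_log, ← fcalc_mul, fcalc_id]
  rw [this, fcalc_trace, Complex.ofReal_re, vonNeumannEntropy, ← Finset.sum_neg_distrib]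
  simp [Real.negMulLog]

theorem self_mul_sind {A : Matrix n n ℂ} (hA : A.IsHermitian) : A * fcalc hA sind = A := by
  have : fcalc hA (fun x => x) * fcalc hA sind = fcalc hA (fun x => x) := by
    rw [fcalc_mul]; congr 1; ext x; unfold sind; split_ifs <;> simp [*]
  rwa [fcalc_id] at this

theorem sind_mul_sind {A : Matrix n n ℂ} (hA : A.IsHermitian) :
    fcalc hA sind * fcalc hA sind = fcalc hA sind := by
  rw [fcalc_mul]; congr 1; ext x; unfold sind; split_ifs <;> simp

theorem inv_mul_self_fcalc {A : Matrix n n ℂ} (hA : A.IsHermitian) :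
    fcalc hA (fun x => x⁻¹) * A = fcalc hA sind := by
  have : fcalc hA (fun x => x⁻¹) * fcalc hA (fun x => x) = fcalc hA sind := by
    rw [fcalc_mul]; congr 1; ext x; unfold sind; split_ifs <;> simp [*]
  rwa [fcalc_id] at this

/-- A projection with zero expectation annihilates the state. -/
theorem psd_mul_proj {R M : Matrix n n ℂ} (hR : R.PosSemidef) (hM : Mᴴ = M) (hMM : M * M = M)
    (h : (R * M).trace = 0) : R * M = 0 := by
  obtain ⟨B, rfl⟩ : ∃ B : Matrix n n ℂ, R = Bᴴ * B := by
    refine ⟨fcalc hR.1 Real.sqrt, ?_⟩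
    rw [fcalc_herm, fcalc_mul]
    conv_lhs => rw [← fcalc_id hR.1]
    unfold fcalc
    congr 3
    ext i
    beta_reduce
    rw [Real.mul_self_sqrt (hR.eigenvalues_nonneg i)]
  have h1 : ((B * M)ᴴ * (B * M)).trace = 0 := by
    rw [← h, conjTranspose_mul, hM, Matrix.mul_assoc, trace_mul_comm]
    simp only [Matrix.mul_assoc, hMM]
  rw [trace_conjTranspose_mul_self_eq_zero_iff] at h1
  rw [Matrix.mul_assoc, h1, Matrix.mul_zero]

end

section
variable {a b : Type*} [Fintype a] [Fintype b] [DecidableEq a] [DecidableEq b]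

theorem fcalc_kron {A : Matrix a a ℂ} {B : Matrix b b ℂ} (hA : A.IsHermitian)
    (hB : B.IsHermitian) (h : (A ⊗ₖ B).IsHermitian) :
    matLog (A ⊗ₖ B) h = matLog A hA ⊗ₖ fcalc hB sind + fcalc hA sind ⊗ₖ matLog B hB := by
  have dec : ∀ f g : ℝ → ℝ, fcalc hA f ⊗ₖ fcalc hB g =
     ((hA.eigenvectorUnitary : Matrix a a ℂ) ⊗ₖ (hB.eigenvectorUnitary : Matrix b b ℂ)) *
      diagonal (fun i : a × b => ((f (hA.eigenvalues i.1) * g (hB.eigenvalues i.2) : ℝ) : ℂ)) *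
      star ((hA.eigenvectorUnitary : Matrix a a ℂ) ⊗ₖ (hB.eigenvectorUnitary : Matrix b b ℂ)) := by
    intro f g
    unfold fcalc
    rw [mul_kronecker_mul, mul_kronecker_mul, diagonal_kronecker_diagonal]
    simp only [star_eq_conjTranspose, conjTranspose_kronecker, Complex.ofReal_mul]
  have d0 := dec (fun x => x) (fun x => x)
  rw [fcalc_id, fcalc_id, ← fcalc_id h, fcalc] at d0
  have hs : star ((hA.eigenvectorUnitary : Matrix a a ℂ) ⊗ₖ (hB.eigenvectorUnitary : Matrix b b ℂ))
    = star (hA.eigenvectorUnitary : Matrix a a ℂ) ⊗ₖ star (hB.eigenvectorUnitary : Matrix b b ℂ) := by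
    simp only [star_eq_conjTranspose, conjTranspose_kronecker]
  have := spec_unique _ _ (U_star_U h) (U_U_star h)
    (by rw [hs, ← mul_kronecker_mul, U_star_U, U_star_U, one_kronecker_one])
    (by rw [hs, ← mul_kronecker_mul, U_U_star, U_U_star, one_kronecker_one])
    _ _ Real.log d0
  rw [fcalc_log, fcalc, this, fcalc_log, fcalc_log, dec, dec, ← Matrix.add_mul, ← Matrix.mul_add,
    diagonal_add]
  congr 3
  ext i
  rw [← Complex.ofReal_add]
  congr 1
  unfold sind
  split_ifs with h1 h2 h2
  · simp [h1, h2]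
  · simp [h1]
  · simp [h2]
  · rw [Real.log_mul h2 h1]; ring

variable {R : Matrix (a × b) (a × b) ℂ} {RA : Matrix a a ℂ} {RB : Matrix b b ℂ}

theorem margA_entry (hRA : ∀ i i', RA i i' = ∑ j : b, R (i, j) (i', j)) (X : Matrix a a ℂ)
    (i i' : a) : (RA * X) i i' = ∑ j : b, (R * (X ⊗ₖ (1 : Matrix b b ℂ))) (i, j) (i', j) := by
  simp only [mul_apply, hRA, Fintype.sum_prod_type, kroneckerMap_apply, one_apply,
    mul_ite, mul_one, mul_zero, Finset.sum_ite_eq', Finset.mem_univ, if_true, Finset.sum_mul]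
  rw [Finset.sum_comm]

theorem margB_entry (hRB : ∀ j j', RB j j' = ∑ i : a, R (i, j) (i, j')) (X : Matrix b b ℂ)
    (j j' : b) : (RB * X) j j' = ∑ i : a, (R * ((1 : Matrix a a ℂ) ⊗ₖ X)) (i, j) (i, j') := by
  simp only [mul_apply, hRB, Fintype.sum_prod_type_right, kroneckerMap_apply, one_apply,
    mul_ite, mul_one, mul_zero, ite_mul, one_mul, zero_mul, Finset.sum_ite_eq', Finset.mem_univ,
    if_true, Finset.sum_mul]
  rw [Finset.sum_comm]

theorem margA_trace (hRA : ∀ i i', RA i i' = ∑ j : b, R (i, j) (i', j)) (X : Matrix a a ℂ) :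
    (R * (X ⊗ₖ (1 : Matrix b b ℂ))).trace = (RA * X).trace := by
  simp only [trace, diag_apply, margA_entry hRA, Fintype.sum_prod_type]

theorem margB_trace (hRB : ∀ j j', RB j j' = ∑ i : a, R (i, j) (i, j')) (X : Matrix b b ℂ) :
    (R * ((1 : Matrix a a ℂ) ⊗ₖ X)).trace = (RB * X).trace := by
  simp only [trace, diag_apply, margB_entry hRB, Fintype.sum_prod_type_right]

theorem supp_split {A : Matrix a a ℂ} {B : Matrix b b ℂ} (hA : A.IsHermitian)
    (hB : B.IsHermitian) (hs : ∀ v, (A ⊗ₖ B) *ᵥ v = 0 → R *ᵥ v = 0) :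
    R * (fcalc hA sind ⊗ₖ (1 : Matrix b b ℂ)) = R ∧
    R * ((1 : Matrix a a ℂ) ⊗ₖ fcalc hB sind) = R := by
  have h0 : (A ⊗ₖ B) * (1 - fcalc hA sind ⊗ₖ fcalc hB sind) = 0 := by
    rw [Matrix.mul_sub, ← mul_kronecker_mul, self_mul_sind, self_mul_sind, Matrix.mul_one, sub_self]
  have h1 : R * (1 - fcalc hA sind ⊗ₖ fcalc hB sind) = 0 := by
    ext i j
    have := hs (fun k => (1 - fcalc hA sind ⊗ₖ fcalc hB sind) k j) (by
      ext i; exact congrFun (congrFun h0 i) j)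
    exact congrFun this i
  rw [Matrix.mul_sub, Matrix.mul_one, sub_eq_zero] at h1
  constructor
  · rw [h1, Matrix.mul_assoc, ← mul_kronecker_mul, sind_mul_sind, Matrix.mul_one, ← h1]
  · rw [h1, Matrix.mul_assoc, ← mul_kronecker_mul, sind_mul_sind, Matrix.mul_one, ← h1]

theorem trace_log_prod (hRA : ∀ i i', RA i i' = ∑ j : b, R (i, j) (i', j))
    (hRB : ∀ j j', RB j j' = ∑ i : a, R (i, j) (i, j'))
    {A : Matrix a a ℂ} {B : Matrix b b ℂ} (hA : A.IsHermitian)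
    (hB : B.IsHermitian) (h : (A ⊗ₖ B).IsHermitian)
    (h1 : R * (fcalc hA sind ⊗ₖ (1 : Matrix b b ℂ)) = R)
    (h2 : R * ((1 : Matrix a a ℂ) ⊗ₖ fcalc hB sind) = R) :
    (R * matLog (A ⊗ₖ B) h).trace = (RA * matLog A hA).trace + (RB * matLog B hB).trace := by
  rw [fcalc_kron hA hB, Matrix.mul_add, trace_add, ← margA_trace hRA, ← margB_trace hRB]
  congr 2
  · conv_rhs => rw [← h2, Matrix.mul_assoc, ← mul_kronecker_mul, Matrix.one_mul, Matrix.mul_one]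
  · conv_rhs => rw [← h1, Matrix.mul_assoc, ← mul_kronecker_mul, Matrix.one_mul, Matrix.mul_one]

theorem marg_supp (hR : R.PosSemidef) (hRA : ∀ i i', RA i i' = ∑ j : b, R (i, j) (i', j))
    (hRB : ∀ j j', RB j j' = ∑ i : a, R (i, j) (i, j'))
    (hA : RA.IsHermitian) (hB : RB.IsHermitian) :
    R * (fcalc hA sind ⊗ₖ (1 : Matrix b b ℂ)) = R ∧
    R * ((1 : Matrix a a ℂ) ⊗ₖ fcalc hB sind) = R := by
  constructor
  · have := psd_mul_proj (M := 1 - fcalc hA sind ⊗ₖ (1 : Matrix b b ℂ)) hR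
      (by simp [conjTranspose_kronecker, fcalc_herm])
      (by rw [Matrix.mul_sub, Matrix.sub_mul, Matrix.sub_mul, ← mul_kronecker_mul, sind_mul_sind]
          simp)
      (by rw [Matrix.mul_sub, trace_sub, margA_trace hRA, self_mul_sind, Matrix.mul_one,
            ← Matrix.mul_one R, ← one_kronecker_one, margA_trace hRA, Matrix.mul_one, sub_self])
    rw [Matrix.mul_sub, Matrix.mul_one, sub_eq_zero] at this
    exact this.symm
  · have := psd_mul_proj (M := 1 - (1 : Matrix a a ℂ) ⊗ₖ fcalc hB sind) hR
      (by simp [conjTranspose_kronecker, fcalc_herm])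
      (by rw [Matrix.mul_sub, Matrix.sub_mul, Matrix.sub_mul, ← mul_kronecker_mul, sind_mul_sind]
          simp)
      (by rw [Matrix.mul_sub, trace_sub, margB_trace hRB, self_mul_sind, Matrix.mul_one,
            ← Matrix.mul_one R, ← one_kronecker_one, margB_trace hRB, Matrix.mul_one, sub_self])
    rw [Matrix.mul_sub, Matrix.mul_one, sub_eq_zero] at this
    exact this.symm

theorem kron_supp {A : Matrix a a ℂ} {B : Matrix b b ℂ} (hA : A.IsHermitian)
    (hB : B.IsHermitian)
    (h1 : R * (fcalc hA sind ⊗ₖ (1 : Matrix b b ℂ)) = R)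
    (h2 : R * ((1 : Matrix a a ℂ) ⊗ₖ fcalc hB sind) = R) :
    ∀ v, (A ⊗ₖ B) *ᵥ v = 0 → R *ᵥ v = 0 := by
  intro v hv
  have h3 : fcalc hA sind ⊗ₖ fcalc hB sind
      = (fcalc hA (fun x => x⁻¹) ⊗ₖ fcalc hB (fun x => x⁻¹)) * (A ⊗ₖ B) := by
    rw [← mul_kronecker_mul, inv_mul_self_fcalc, inv_mul_self_fcalc]
  have h4 : R = R * (fcalc hA sind ⊗ₖ fcalc hB sind) := by
    have : fcalc hA sind ⊗ₖ fcalc hB sind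
      = (fcalc hA sind ⊗ₖ (1 : Matrix b b ℂ)) * ((1 : Matrix a a ℂ) ⊗ₖ fcalc hB sind) := by
      rw [← mul_kronecker_mul, Matrix.one_mul, Matrix.mul_one]
    rw [this, ← Matrix.mul_assoc, h1, h2]
  rw [h4, h3, ← mulVec_mulVec, ← mulVec_mulVec, hv, mulVec_zero, mulVec_zero]

end

/-- **Chain rule for the relative entropy to product states, and the mutual
information as a minimum.** For a density operator `ρ` on a finite-dimensional
bipartite Hilbert space with marginals `ρ_A`, `ρ_B`, and density operators `σ_A`,
`σ_B` with `supp ρ ⊆ supp (σ_A ⊗ σ_B)`, one has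
`S(ρ ‖ σ_A ⊗ σ_B) = S(ρ ‖ ρ_A ⊗ ρ_B) + S(ρ_A ‖ σ_A) + S(ρ_B ‖ σ_B)`;
consequently the mutual information `I(ρ) = S(ρ_A) + S(ρ_B) − S(ρ)` is the minimum of
`S(ρ ‖ σ_A ⊗ σ_B)` over all uncorrelated (product) density operators `σ_A ⊗ σ_B`
with `supp ρ ⊆ supp (σ_A ⊗ σ_B)`. -/
theorem relEntropy_product_chain_rule_and_mutual_information
    {ιA ιB : Type*} [Fintype ιA] [Fintype ιB] [DecidableEq ιA] [DecidableEq ιB]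
    (ρ : Matrix (ιA × ιB) (ιA × ιB) ℂ) (hρ : ρ.PosSemidef) (htr : ρ.trace = 1)
    (ρA : Matrix ιA ιA ℂ) (hρA : ∀ i i', ρA i i' = ∑ j : ιB, ρ (i, j) (i', j))
    (ρB : Matrix ιB ιB ℂ) (hρB : ∀ j j', ρB j j' = ∑ i : ιA, ρ (i, j) (i, j'))
    (hA : ρA.PosSemidef) (hB : ρB.PosSemidef)
    (hAB : (ρA ⊗ₖ ρB).IsHermitian)
    (σA : Matrix ιA ιA ℂ) (σB : Matrix ιB ιB ℂ)
    (hσA : σA.PosSemidef) (hσB : σB.PosSemidef)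
    (hσAtr : σA.trace = 1) (hσBtr : σB.trace = 1)
    (hσ : (σA ⊗ₖ σB).IsHermitian)
    (hsupp : ∀ v, (σA ⊗ₖ σB) *ᵥ v = 0 → ρ *ᵥ v = 0) :
    relEntropy ρ (σA ⊗ₖ σB) hρ.1 hσ
        = relEntropy ρ (ρA ⊗ₖ ρB) hρ.1 hAB
          + relEntropy ρA σA hA.1 hσA.1 + relEntropy ρB σB hB.1 hσB.1 ∧
    IsLeast
      {x : ℝ | ∃ (τA : Matrix ιA ιA ℂ) (τB : Matrix ιB ιB ℂ)
        (hτA : τA.PosSemidef) (hτB : τB.PosSemidef) (hτ : (τA ⊗ₖ τB).IsHermitian),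
        τA.trace = 1 ∧ τB.trace = 1 ∧
        (∀ v, (τA ⊗ₖ τB) *ᵥ v = 0 → ρ *ᵥ v = 0) ∧
        x = relEntropy ρ (τA ⊗ₖ τB) hρ.1 hτ}
      (vonNeumannEntropy hA.1 + vonNeumannEntropy hB.1 - vonNeumannEntropy hρ.1) := by
  have hm := marg_supp hρ hρA hρB hA.1 hB.1
  have htA : ρA.trace = 1 := by
    rw [← htr, ← Matrix.mul_one ρA, ← margA_trace hρA, one_kronecker_one, Matrix.mul_one]
  have htB : ρB.trace = 1 := by
    rw [← htr, ← Matrix.mul_one ρB, ← margB_trace hρB, one_kronecker_one, Matrix.mul_one]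
  have hmain := trace_log_prod hρA hρB hA.1 hB.1 hAB hm.1 hm.2
  have chain : ∀ (τA : Matrix ιA ιA ℂ) (τB : Matrix ιB ιB ℂ)
        (hτA : τA.PosSemidef) (hτB : τB.PosSemidef) (hτ : (τA ⊗ₖ τB).IsHermitian),
        (∀ v, (τA ⊗ₖ τB) *ᵥ v = 0 → ρ *ᵥ v = 0) →
        relEntropy ρ (τA ⊗ₖ τB) hρ.1 hτ
        = relEntropy ρ (ρA ⊗ₖ ρB) hρ.1 hAB
          + relEntropy ρA τA hA.1 hτA.1 + relEntropy ρB τB hB.1 hτB.1 := by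
    intro τA τB hτA hτB hτ hs
    obtain ⟨h1, h2⟩ := supp_split hτA.1 hτB.1 hs
    have := trace_log_prod hρA hρB hτA.1 hτB.1 hτ h1 h2
    simp only [relEntropy, Matrix.mul_sub, trace_sub, this, hmain, Complex.sub_re, Complex.add_re]
    ring
  have hI : vonNeumannEntropy hA.1 + vonNeumannEntropy hB.1 - vonNeumannEntropy hρ.1
      = relEntropy ρ (ρA ⊗ₖ ρB) hρ.1 hAB := by
    simp only [relEntropy, Matrix.mul_sub, trace_sub, hmain, Complex.sub_re, Complex.add_re,
      trace_self_log]
    ring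
  refine ⟨chain σA σB hσA hσB hσ hsupp, ?_, ?_⟩
  · exact ⟨ρA, ρB, hA, hB, hAB, htA, htB, kron_supp hA.1 hB.1 hm.1 hm.2, hI⟩
  · rintro x ⟨τA, τB, hτA, hτB, hτ, h1, h2, hs, rfl⟩
    obtain ⟨s1, s2⟩ := supp_split hτA.1 hτB.1 hs
    have kA := klein hA hτA (htA.trans h1.symm) (by
      ext i j; rw [margA_entry hρA, s1, hρA])
    have kB := klein hB hτB (htB.trans h2.symm) (by
      ext i j; rw [margB_entry hρB, s2, hρB])
    rw [hI, chain τA τB hτA hτB hτ hs]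
    linarith
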